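/- arXiv:1811.03538 — 7 statements merged into one kernel-verified Lean document; each statement's English description precedes it below -/
import Mathlib

section
/- Let T_1(c_1,p_1,φ_1,d_1), …, T_N(c_N,p_N,φ_N,d_N) be periodic tasks with c_i > 0, p_i > 0, φ_i ≥ 0, d_i > 0. The task set is feasible on a preemptive unit-speed processor (i.e., a preemptive unit-speed schedule meeting all deadlines exists) if and only if for all real numbers t_1 < t_2, Σ_{i=1}^N df_i(t_1, t_2) ≤ t_2 − t_1. -/
open MeasureTheory

/-- Demand function of a periodic task with WCET `c`, period `p`, offset `φ`, relative
deadline `d` on the interval `[t1, t2]`. -/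
noncomputable def demand (c p φ d t1 t2 : ℝ) : ℝ :=
  c * (({j : ℕ | t1 ≤ φ + (j : ℝ) * p ∧ φ + (j : ℝ) * p + d ≤ t2}).ncard : ℝ)

/-- Feasibility of a periodic task set on a preemptive unit-speed processor: there is a
family of measurable service-rate functions `α (i,j) : ℝ → [0,1]` (one per job), with total
rate at most `1` at every time, each vanishing outside the window from the release time to
the absolute deadline of the corresponding job, and each delivering `c i` units of service. -/
def Feasible {N : ℕ} (c p φ d : Fin N → ℝ) : Prop :=
  ∃ α : Fin N × ℕ → ℝ → ℝ,
    (∀ ij, Measurable (α ij)) ∧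
    (∀ ij t, α ij t ∈ Set.Icc (0 : ℝ) 1) ∧
    (∀ t : ℝ, ∑' ij : Fin N × ℕ, α ij t ≤ 1) ∧
    (∀ ij : Fin N × ℕ, ∀ t : ℝ,
      t ∉ Set.Icc (φ ij.1 + (ij.2 : ℝ) * p ij.1)
        (φ ij.1 + (ij.2 : ℝ) * p ij.1 + d ij.1) → α ij t = 0) ∧
    (∀ ij : Fin N × ℕ, ∫ t : ℝ, α ij t = c ij.1)

theorem aux_ivt (r D c : ℝ) (U : Set ℝ) (hrD : r ≤ D) (hc : 0 ≤ c)
    (h : c ≤ volume.real (Set.Icc r D \ U)) :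
    ∃ x ∈ Set.Icc r D, volume.real (Set.Icc r x \ U) = c := by
  have hcont : Continuous (fun x => volume.real (Set.Icc r x \ U)) := by
    apply LipschitzWith.continuous (K := 1)
    apply LipschitzWith.of_le_add
    intro x y
    have hsub : Set.Icc r x \ U ⊆ (Set.Icc r y \ U) ∪ Set.Icc y x := by
      rintro z ⟨⟨h1, h2⟩, h3⟩
      by_cases hz : z ≤ y
      · exact Or.inl ⟨⟨h1, hz⟩, h3⟩
      · exact Or.inr ⟨le_of_not_ge hz, h2⟩
    have hfin : volume ((Set.Icc r y \ U) ∪ Set.Icc y x) ≠ ⊤ := by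
      apply ne_of_lt
      refine lt_of_le_of_lt (measure_union_le _ _) ?_
      refine ENNReal.add_lt_top.2 ⟨?_, measure_Icc_lt_top⟩
      exact lt_of_le_of_lt (measure_mono Set.sdiff_subset) measure_Icc_lt_top
    calc volume.real (Set.Icc r x \ U) ≤ volume.real ((Set.Icc r y \ U) ∪ Set.Icc y x) :=
          measureReal_mono hsub hfin
      _ ≤ volume.real (Set.Icc r y \ U) + volume.real (Set.Icc y x) := measureReal_union_le _ _
      _ ≤ volume.real (Set.Icc r y \ U) + dist x y := by
          gcongr
          rw [Real.volume_real_Icc, Real.dist_eq]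
          exact max_le (le_abs_self _) (abs_nonneg _)
  have h0 : volume.real (Set.Icc r r \ U) = 0 := by
    apply le_antisymm _ measureReal_nonneg
    calc volume.real (Set.Icc r r \ U) ≤ volume.real (Set.Icc r r) :=
          measureReal_mono Set.sdiff_subset measure_Icc_lt_top.ne
      _ = 0 := by rw [Real.volume_real_Icc_of_le le_rfl, sub_self]
  have := intermediate_value_Icc hrD hcont.continuousOn
  obtain ⟨x, hx, hx2⟩ := this (show c ∈ Set.Icc _ _ from ⟨h0.le.trans hc, h⟩)
  exact ⟨x, hx, hx2⟩

open Classical in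
/-- Finishing time of a job scheduled greedily outside of `U`. -/
noncomputable def finTime (r D c : ℝ) (U : Set ℝ) : ℝ :=
  if h : ∃ x ∈ Set.Icc r D, volume.real (Set.Icc r x \ U) = c then h.choose else r

/-- Time occupied by the first `k` jobs. -/
noncomputable def occ (r D c : ℕ → ℝ) : ℕ → Set ℝ
  | 0 => ∅
  | k + 1 => occ r D c k ∪ (Set.Icc (r k) (finTime (r k) (D k) (c k) (occ r D c k)) \ occ r D c k)

/-- One greedy step preserves the workload bound. -/
theorem aux_step (r f c : ℝ) (U : Set ℝ) (hU : MeasurableSet U) (hUf : volume U ≠ ⊤)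
    (hf : r ≤ f) (hc : 0 ≤ c) (hA : volume.real (Set.Icc r f \ U) = c) (C : ℝ → ℝ)
    (hinv : ∀ t, ∃ s ≤ t, volume.real (U ∩ Set.Ici t) ≤ C s - (t - s)) (t : ℝ) :
    ∃ s ≤ t, volume.real ((U ∪ (Set.Icc r f \ U)) ∩ Set.Ici t) ≤
      (C s + if s ≤ r then c else 0) - (t - s) := by
  have hAf : volume (Set.Icc r f \ U) ≠ ⊤ :=
    (lt_of_le_of_lt (measure_mono Set.sdiff_subset) measure_Icc_lt_top).ne
  have hVf : volume (U ∪ (Set.Icc r f \ U)) ≠ ⊤ :=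
    (lt_of_le_of_lt (measure_union_le _ _)
      (ENNReal.add_lt_top.2 ⟨hUf.lt_top, hAf.lt_top⟩)).ne
  have hVm : MeasurableSet (U ∪ (Set.Icc r f \ U)) := hU.union (measurableSet_Icc.diff hU)
  have key : ∀ t ≤ r, ∃ s ≤ t, volume.real ((U ∪ (Set.Icc r f \ U)) ∩ Set.Ici t) ≤
      (C s + if s ≤ r then c else 0) - (t - s) := by
    intro t ht
    obtain ⟨s, hs, h⟩ := hinv t
    refine ⟨s, hs, ?_⟩
    rw [if_pos (hs.trans ht)]
    have h1 : volume.real ((U ∪ (Set.Icc r f \ U)) ∩ Set.Ici t) ≤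
        volume.real (U ∩ Set.Ici t) + volume.real (Set.Icc r f \ U) := by
      refine le_trans (measureReal_mono ?_ ?_) (measureReal_union_le _ _)
      · rintro z ⟨hz | hz, hz2⟩
        · exact Or.inl ⟨hz, hz2⟩
        · exact Or.inr hz
      · exact ((measure_mono (Set.union_subset_union_left _ Set.inter_subset_left)).trans_lt
          hVf.lt_top).ne
    linarith
  rcases le_or_gt t r with ht | ht
  · exact key t ht
  rcases le_or_gt t f with htf | htf
  · obtain ⟨s, hs, h⟩ := key r le_rfl
    refine ⟨s, hs.trans ht.le, ?_⟩
    have h2 : volume.real ((U ∪ (Set.Icc r f \ U)) ∩ Set.Ici t) + volume.real (Set.Ico r t) ≤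
        volume.real ((U ∪ (Set.Icc r f \ U)) ∩ Set.Ici r) := by
      rw [← measureReal_union _ measurableSet_Ico
        ((measure_mono Set.inter_subset_left).trans_lt hVf.lt_top).ne measure_Ico_lt_top.ne]
      · refine measureReal_mono ?_
          ((measure_mono Set.inter_subset_left).trans_lt hVf.lt_top).ne
        rintro z (⟨hz, hz2⟩ | ⟨hz, hz2⟩)
        · exact ⟨hz, ht.le.trans hz2⟩
        · refine ⟨?_, hz⟩
          by_cases hzU : z ∈ U
          · exact Or.inl hzU
          · exact Or.inr ⟨⟨hz, hz2.le.trans htf⟩, hzU⟩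
      · rw [Set.disjoint_left]
        rintro z ⟨_, hz⟩ ⟨_, hz2⟩
        exact absurd hz2 (not_lt.2 hz)
    rw [Real.volume_real_Ico_of_le ht.le] at h2
    linarith
  · obtain ⟨s, hs, h⟩ := hinv t
    refine ⟨s, hs, ?_⟩
    have h1 : (U ∪ (Set.Icc r f \ U)) ∩ Set.Ici t = U ∩ Set.Ici t := by
      ext z
      constructor
      · rintro ⟨hz | hz, hz2⟩
        · exact ⟨hz, hz2⟩
        · exact absurd (hz.1.2.trans_lt htf) (not_lt.2 hz2)
      · rintro ⟨hz, hz2⟩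
        exact ⟨Or.inl hz, hz2⟩
    rw [h1]
    have : (0 : ℝ) ≤ if s ≤ r then c else 0 := by split_ifs <;> simp [hc]
    linarith

theorem aux_seq (r D c : ℕ → ℝ) (hD : Monotone D) (hrD : ∀ k, r k ≤ D k) (hc : ∀ k, 0 ≤ c k)
    (H : ∀ k s, s ≤ r k → ∑ i ∈ Finset.range (k + 1), (if s ≤ r i then c i else 0) ≤ D k - s) :
    ∃ A : ℕ → Set ℝ, (∀ k, MeasurableSet (A k)) ∧ (∀ k, A k ⊆ Set.Icc (r k) (D k)) ∧
      (∀ k, volume.real (A k) = c k) ∧ (∀ i j, i < j → Disjoint (A i) (A j)) := by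
  set U := occ r D c with hUdef
  set f : ℕ → ℝ := fun k => finTime (r k) (D k) (c k) (U k) with hfdef
  have hUs : ∀ k, U (k + 1) = U k ∪ (Set.Icc (r k) (f k) \ U k) := fun k => rfl
  have spec : ∀ k, (MeasurableSet (U k) ∧ volume (U k) ≠ ⊤ ∧ U k ⊆ Set.Iic (D k) ∧
      ∀ t, ∃ s ≤ t, volume.real (U k ∩ Set.Ici t) ≤
        (∑ i ∈ Finset.range k, (if s ≤ r i then c i else 0)) - (t - s)) →
      f k ∈ Set.Icc (r k) (D k) ∧ volume.real (Set.Icc (r k) (f k) \ U k) = c k := by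
    rintro k ⟨hm, hfin, hsub, hinv⟩
    have hex : ∃ x ∈ Set.Icc (r k) (D k), volume.real (Set.Icc (r k) x \ U k) = c k := by
      apply aux_ivt _ _ _ _ (hrD k) (hc k)
      obtain ⟨s, hs, h⟩ := hinv (r k)
      have h1 := H k s hs
      rw [Finset.sum_range_succ, if_pos hs] at h1
      have h2 : volume.real (Set.Icc (r k) (D k)) ≤
          volume.real (Set.Icc (r k) (D k) \ U k) + volume.real (U k ∩ Set.Ici (r k)) := by
        refine le_trans (measureReal_mono ?_ ?_) (measureReal_union_le _ _)
        · intro z hz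
          by_cases hzU : z ∈ U k
          · exact Or.inr ⟨hzU, hz.1⟩
          · exact Or.inl ⟨hz, hzU⟩
        · refine (lt_of_le_of_lt (measure_union_le _ _) (ENNReal.add_lt_top.2 ⟨?_, ?_⟩)).ne
          · exact lt_of_le_of_lt (measure_mono Set.sdiff_subset) measure_Icc_lt_top
          · exact (measure_mono Set.inter_subset_left).trans_lt hfin.lt_top
      rw [Real.volume_real_Icc_of_le (hrD k)] at h2
      linarith
    have hfk : f k = hex.choose := by
      simp only [hfdef, finTime]
      rw [dif_pos hex]
    rw [hfk]
    exact hex.choose_spec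
  have main : ∀ k, (MeasurableSet (U k) ∧ volume (U k) ≠ ⊤ ∧ U k ⊆ Set.Iic (D k) ∧
      ∀ t, ∃ s ≤ t, volume.real (U k ∩ Set.Ici t) ≤
        (∑ i ∈ Finset.range k, (if s ≤ r i then c i else 0)) - (t - s)) := by
    intro k
    induction k with
    | zero =>
      have h0 : U 0 = ∅ := rfl
      rw [h0]
      refine ⟨MeasurableSet.empty, by simp, by simp, fun t => ⟨t, le_rfl, by simp⟩⟩
    | succ k ih =>
      obtain ⟨hf, hA⟩ := spec k ih
      obtain ⟨hm, hfin, hsub, hinv⟩ := ih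
      rw [hUs]
      refine ⟨hm.union (measurableSet_Icc.diff hm), ?_, ?_, ?_⟩
      · refine (lt_of_le_of_lt (measure_union_le _ _)
          (ENNReal.add_lt_top.2 ⟨hfin.lt_top, ?_⟩)).ne
        exact lt_of_le_of_lt (measure_mono Set.sdiff_subset) measure_Icc_lt_top
      · have hmon := hD (Nat.le_succ k)
        rintro z (hz | hz)
        · exact (hsub hz).trans hmon
        · exact (hz.1.2.trans hf.2).trans hmon
      · intro t
        obtain ⟨s, hs, h⟩ := aux_step (r k) (f k) (c k) (U k) hm hfin hf.1 (hc k) hA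
          (fun s => ∑ i ∈ Finset.range k, (if s ≤ r i then c i else 0)) hinv t
        refine ⟨s, hs, ?_⟩
        rw [Finset.sum_range_succ]
        exact h
  have hUmono : Monotone U := monotone_nat_of_le_succ (fun k => by
    rw [hUs]; exact Set.subset_union_left)
  refine ⟨fun k => Set.Icc (r k) (f k) \ U k, fun k => measurableSet_Icc.diff (main k).1,
    fun k z hz => ⟨hz.1.1, hz.1.2.trans (spec k (main k)).1.2⟩,
    fun k => (spec k (main k)).2, ?_⟩
  intro i j hij
  rw [Set.disjoint_left]
  intro z hz hz2
  apply hz2.2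
  apply hUmono (Nat.succ_le_of_lt hij)
  rw [Nat.succ_eq_add_one, hUs]
  exact Or.inr hz

theorem aux_enum {J : Type*} [Infinite J] [Countable J] (D : J → ℝ)
    (hfin : ∀ t, {x | D x ≤ t}.Finite) :
    ∃ e : ℕ ≃ J, Monotone (fun k => D (e k)) := by
  obtain ⟨g, hg⟩ := exists_injective_nat J
  let F : J → ℝ ×ₗ ℕ := fun x => toLex (D x, g x)
  have hF : Function.Injective F := by
    intro x y h
    apply hg
    have := congrArg (fun z => (ofLex z).2) h
    simpa [F] using this
  letI : LinearOrder J := LinearOrder.lift' F hF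
  have hDm : Monotone D := by
    intro x y h
    have h' : F x ≤ F y := h
    simp only [F, Prod.Lex.toLex_le_toLex] at h'
    rcases h' with h' | h'
    · exact h'.le
    · exact h'.1.le
  have hIic : ∀ x : J, (Set.Iic x).Finite := fun x =>
    (hfin (D x)).subset (fun y hy => hDm hy)
  letI : LocallyFiniteOrder J := LocallyFiniteOrder.ofFiniteIcc
    (fun a b => (hIic b).subset (fun y hy => hy.2))
  haveI : NoMaxOrder J := ⟨fun a => by
    by_contra hcon
    push Not at hcon
    exact Set.infinite_univ ((hIic a).subset (fun y _ => hcon y))⟩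
  have hbot : ∃ b : J, ∀ x, b ≤ x := by
    obtain ⟨a⟩ : Nonempty J := inferInstance
    obtain ⟨b, hb, hb2⟩ := Set.exists_min_image (Set.Iic a) id (hIic a) ⟨a, le_refl a⟩
    refine ⟨b, fun x => ?_⟩
    rcases le_total x a with h | h
    · exact hb2 x h
    · exact le_trans hb h
  letI : OrderBot J := { bot := hbot.choose, bot_le := hbot.choose_spec }
  letI : SuccOrder J := LinearLocallyFiniteOrder.succOrder J
  letI : PredOrder J := LinearLocallyFiniteOrder.predOrder J
  let e : J ≃o ℕ := orderIsoNatOfLinearSuccPredArch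
  exact ⟨e.symm.toEquiv, fun a b h => hDm (e.symm.monotone h)⟩

theorem aux_finite {N : ℕ} (p φ : Fin N → ℝ) (hp : ∀ i, 0 < p i) (t : ℝ) :
    {x : Fin N × ℕ | φ x.1 + (x.2 : ℝ) * p x.1 ≤ t}.Finite := by
  have h : {x : Fin N × ℕ | φ x.1 + (x.2 : ℝ) * p x.1 ≤ t} ⊆
      ⋃ i : Fin N, Prod.mk i '' (Set.Iic ⌊(t - φ i) / p i⌋₊) := by
    rintro ⟨i, j⟩ hx
    simp only [Set.mem_ofPred_eq] at hx
    refine Set.mem_iUnion.2 ⟨i, j, ?_, rfl⟩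
    apply Nat.le_floor
    rw [le_div_iff₀ (hp i)]
    linarith
  exact (Set.finite_iUnion (fun i => (Set.finite_Iic _).image _)).subset h

theorem aux_demand {N : ℕ} (c p φ d : Fin N → ℝ) (hp : ∀ i, 0 < p i) (hd : ∀ i, 0 < d i)
    (t1 t2 : ℝ) : ∃ S : Finset (Fin N × ℕ),
      (∀ x, x ∈ S ↔ t1 ≤ φ x.1 + (x.2 : ℝ) * p x.1 ∧ φ x.1 + (x.2 : ℝ) * p x.1 + d x.1 ≤ t2) ∧
      ∑ i, demand (c i) (p i) (φ i) (d i) t1 t2 = ∑ x ∈ S, c x.1 := by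
  have hfin : {x : Fin N × ℕ | t1 ≤ φ x.1 + (x.2 : ℝ) * p x.1 ∧
      φ x.1 + (x.2 : ℝ) * p x.1 + d x.1 ≤ t2}.Finite :=
    (aux_finite p φ hp t2).subset (fun x hx => by
      have := hd x.1
      have := hx.2
      simp only [Set.mem_ofPred_eq]
      linarith)
  have hfi : ∀ i, {j : ℕ | t1 ≤ φ i + (j : ℝ) * p i ∧ φ i + (j : ℝ) * p i + d i ≤ t2}.Finite :=
    fun i => hfin.preimage (f := Prod.mk i) (Prod.mk_right_injective i).injOn
  refine ⟨hfin.toFinset, fun x => by simp, ?_⟩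
  rw [Finset.sum_finset_product hfin.toFinset Finset.univ (fun i => (hfi i).toFinset)
    (fun x => by simp)]
  refine Finset.sum_congr rfl fun i _ => ?_
  rw [demand, Set.ncard_eq_toFinset_card _ (hfi i)]
  simp only [Finset.sum_const, nsmul_eq_mul]
  rw [mul_comm]

/-- A periodic task set is feasible on a preemptive unit-speed processor if and only if the
total demand on every interval `[t1, t2]` is at most its length. -/
theorem stmt1 {N : ℕ} (c p φ d : Fin N → ℝ)
    (hc : ∀ i, 0 < c i) (hp : ∀ i, 0 < p i) (hφ : ∀ i, 0 ≤ φ i) (hd : ∀ i, 0 < d i) :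
    Feasible c p φ d ↔
      ∀ t1 t2 : ℝ, t1 < t2 →
        ∑ i, demand (c i) (p i) (φ i) (d i) t1 t2 ≤ t2 - t1 := by
  constructor
  · rintro ⟨α, hm, h01, hsum, hvan, hint⟩ t1 t2 ht
    obtain ⟨S, hS, hSe⟩ := aux_demand c p φ d hp hd t1 t2
    rw [hSe]
    have hI : ∀ x, Integrable (α x) := by
      intro x
      by_contra hcon
      have h1 := hint x
      rw [integral_undef hcon] at h1
      exact (hc x.1).ne h1
    have hle : ∀ t, ∑ x ∈ S, α x t ≤ (Set.Icc t1 t2).indicator (fun _ => (1 : ℝ)) t := by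
      intro t
      by_cases htm : t ∈ Set.Icc t1 t2
      · rw [Set.indicator_of_mem htm]
        refine le_trans (Summable.sum_le_tsum S (fun x _ => (h01 x t).1) ?_) (hsum t)
        refine summable_of_hasFiniteSupport ?_
        refine (aux_finite p φ hp t).subset (fun x hx => ?_)
        by_contra hcon
        exact hx (hvan x t (fun h => hcon h.1))
      · rw [Set.indicator_of_notMem htm]
        refine (Finset.sum_eq_zero fun x hx => hvan x t fun h => htm ?_).le
        have h2 := (hS x).1 hx
        exact ⟨h2.1.trans h.1, h.2.trans h2.2⟩
    calc ∑ x ∈ S, c x.1 = ∑ x ∈ S, ∫ t, α x t := by simp only [hint]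
      _ = ∫ t, ∑ x ∈ S, α x t := (integral_finsetSum S fun x _ => hI x).symm
      _ ≤ ∫ t, (Set.Icc t1 t2).indicator (fun _ => (1 : ℝ)) t := by
          refine integral_mono (integrable_finsetSum S fun x _ => hI x) ?_ hle
          exact (integrable_indicator_iff measurableSet_Icc).2
            (integrableOn_const measure_Icc_lt_top.ne)
      _ = t2 - t1 := by
          rw [integral_indicator measurableSet_Icc]
          simp [Real.volume_real_Icc_of_le ht.le]
  · intro H
    rcases Nat.eq_zero_or_pos N with rfl | hN
    · exact ⟨fun _ _ => 0, fun _ => measurable_const, fun _ _ => by simp, fun _ => by simp,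
        fun _ _ _ => rfl, fun x => x.1.elim0⟩
    haveI : Nonempty (Fin N) := ⟨⟨0, hN⟩⟩
    obtain ⟨e, he⟩ := aux_enum (fun x : Fin N × ℕ => φ x.1 + (x.2 : ℝ) * p x.1 + d x.1)
      (fun t => (aux_finite p φ hp t).subset fun x hx => by
        have := hd x.1
        simp only [Set.mem_ofPred_eq] at hx ⊢
        linarith)
    obtain ⟨A, hAm, hAsub, hAv, hAd⟩ := aux_seq
      (fun k => φ (e k).1 + ((e k).2 : ℝ) * p (e k).1)
      (fun k => φ (e k).1 + ((e k).2 : ℝ) * p (e k).1 + d (e k).1)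
      (fun k => c (e k).1) he (fun k => by have := hd (e k).1; linarith)
      (fun k => (hc _).le) (by
        intro k s hs
        have hlt : s < φ (e k).1 + ((e k).2 : ℝ) * p (e k).1 + d (e k).1 := by
          have := hd (e k).1
          linarith
        refine le_trans ?_ (H s _ hlt)
        obtain ⟨S, hS, hSe⟩ := aux_demand c p φ d hp hd s
          (φ (e k).1 + ((e k).2 : ℝ) * p (e k).1 + d (e k).1)
        rw [hSe, ← Finset.sum_filter]
        refine le_trans (Finset.sum_map _ e.toEmbedding (fun x => c x.1)).ge ?_
        refine Finset.sum_le_sum_of_subset_of_nonneg ?_ (fun x _ _ => (hc _).le)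
        intro x hx
        obtain ⟨i, hi, rfl⟩ := Finset.mem_map.1 hx
        rw [Finset.mem_filter, Finset.mem_range] at hi
        exact (hS _).2 ⟨hi.2, he (Nat.lt_succ_iff.1 hi.1)⟩)
    have hdis : ∀ i j, i ≠ j → Disjoint (A i) (A j) := by
      intro i j hij
      rcases lt_or_gt_of_ne hij with h | h
      · exact hAd i j h
      · exact (hAd j i h).symm
    refine ⟨fun x => (A (e.symm x)).indicator (fun _ => (1 : ℝ)),
      fun x => measurable_const.indicator (hAm _), ?_, ?_, ?_, ?_⟩
    · intro x t
      by_cases h : t ∈ A (e.symm x)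
      · simp [Set.indicator_of_mem h]
      · simp [Set.indicator_of_notMem h]
    · intro t
      by_cases h : ∃ x, t ∈ A (e.symm x)
      · obtain ⟨x, hx⟩ := h
        rw [tsum_eq_single x]
        · simp [Set.indicator_of_mem hx]
        · intro y hy
          apply Set.indicator_of_notMem
          intro hy2
          exact Set.disjoint_left.1 (hdis _ _ (fun h => hy (e.symm.injective h))) hy2 hx
      · push Not at h
        have : ∀ x, (A (e.symm x)).indicator (fun _ => (1 : ℝ)) t = 0 :=
          fun x => Set.indicator_of_notMem (h x) _
        simp [this]
    · intro x t ht
      apply Set.indicator_of_notMem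
      intro h
      have := hAsub _ h
      simp only [Equiv.apply_symm_apply] at this
      exact ht this
    · intro x
      rw [integral_indicator (hAm _)]
      have := hAv (e.symm x)
      simp only [Equiv.apply_symm_apply] at this
      simp [this]
end

section
/- Consider the two periodic messages M_1 with transmission time c_1 = 2, period p_1 = 5, offset φ_1 = 2, relative deadline d_1 = 3, and M_2 with c_2 = 2.1, p_2 = 10, φ_2 = 1, d_2 = 10. In every non-idling non-preemptive schedule of their jobs, the first job of M_2 starts transmission exactly at time 1 and occupies the channel on [1, 3.1), so the first job of M_1 (released at time 2, absolute deadline 5) cannot start before time 3.1 and completes no earlier than time 5.1 > 5. Hence this message set admits no non-idling non-preemptive schedule meeting all deadlines; in particular it is not schedulable by non-preemptive EDF. -/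
/-- Release time of job `k` of message `i`. -/
def release {N : ℕ} (p φ : Fin N → ℝ) (i : Fin N) (k : ℕ) : ℝ := φ i + (k : ℝ) * p i

/-- A non-idling non-preemptive schedule: every job starts at or after its release, the
transmission intervals `[σ i k, σ i k + c i)` are pairwise disjoint, and there is no time
at which some released job has not yet started while no job is being transmitted. -/
def NonIdlingNonPreemptive {N : ℕ} (c p φ : Fin N → ℝ) (σ : Fin N → ℕ → ℝ) : Prop :=
  (∀ i k, release p φ i k ≤ σ i k) ∧
  (∀ i k j l, (i, k) ≠ (j, l) → σ i k + c i ≤ σ j l ∨ σ j l + c j ≤ σ i k) ∧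
  (¬ ∃ t : ℝ, (∃ i k, release p φ i k ≤ t ∧ t < σ i k) ∧
    (∀ j l, ¬ (σ j l ≤ t ∧ t < σ j l + c j)))

/-- Transmission times of the two messages `M_1, M_2`. -/
noncomputable def c3 : Fin 2 → ℝ := ![2, 2.1]
/-- Periods of the two messages. -/
noncomputable def p3 : Fin 2 → ℝ := ![5, 10]
/-- Offsets of the two messages. -/
noncomputable def φ3 : Fin 2 → ℝ := ![2, 1]
/-- Relative deadlines of the two messages. -/
noncomputable def d3 : Fin 2 → ℝ := ![3, 10]

/-- In every non-idling non-preemptive schedule of the jobs of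
`M_1(c=2, p=5, φ=2, d=3)` and `M_2(c=2.1, p=10, φ=1, d=10)`, the first job of `M_2`
starts exactly at time `1`, the first job of `M_1` cannot start before time `3.1` and
completes no earlier than `5.1 > 5`; hence no non-idling non-preemptive schedule (in
particular, no non-preemptive EDF schedule) meets all deadlines. -/
theorem stmt3 :
    (∀ σ : Fin 2 → ℕ → ℝ, NonIdlingNonPreemptive c3 p3 φ3 σ →
      σ 1 0 = 1 ∧ 3.1 ≤ σ 0 0 ∧ 5.1 ≤ σ 0 0 + c3 0 ∧ (5.1 : ℝ) > 5) ∧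
    ¬ ∃ σ : Fin 2 → ℕ → ℝ, NonIdlingNonPreemptive c3 p3 φ3 σ ∧
      ∀ i k, σ i k + c3 i ≤ release p3 φ3 i k + d3 i := by
  have key : ∀ σ : Fin 2 → ℕ → ℝ, NonIdlingNonPreemptive c3 p3 φ3 σ →
      σ 1 0 = 1 ∧ 3.1 ≤ σ 0 0 ∧ 5.1 ≤ σ 0 0 + c3 0 ∧ (5.1 : ℝ) > 5 := by
    rintro σ ⟨hr, hd, hn⟩
    have r0 : ∀ k : ℕ, 2 + (k : ℝ) * 5 ≤ σ 0 k := fun k => by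
      simpa [release, φ3, p3] using hr 0 k
    have r1 : ∀ k : ℕ, 1 + (k : ℝ) * 10 ≤ σ 1 k := fun k => by
      simpa [release, φ3, p3] using hr 1 k
    have h00 := r0 0
    have h10 := r1 0
    norm_num at h00 h10
    have h1 : σ 1 0 = 1 := by
      by_contra hne
      have hlt : 1 < σ 1 0 := lt_of_le_of_ne h10 (Ne.symm hne)
      refine hn ⟨1, ⟨1, 0, by simp [release, φ3, p3], hlt⟩, ?_⟩
      intro j l hjl
      have hle := hjl.1
      fin_cases j
      · have h := r0 l
        have hl : (0 : ℝ) ≤ l := Nat.cast_nonneg l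
        simp at hle
        linarith
      · simp at hle
        rcases Nat.eq_zero_or_pos l with h0 | hpos
        · subst h0
          linarith
        · have h := r1 l
          have hl : (0 : ℝ) < l := Nat.cast_pos.mpr hpos
          linarith
    have hc0 : c3 0 = 2 := by simp [c3]
    have hc1 : c3 1 = 2.1 := by simp [c3]
    have h2 : (3.1 : ℝ) ≤ σ 0 0 := by
      rcases hd 0 0 1 0 (by simp) with h | h
      · rw [hc0, h1] at h
        linarith
      · rw [hc1, h1] at h
        norm_num at h ⊢
        linarith
    refine ⟨h1, h2, ?_, by norm_num⟩
    rw [hc0]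
    norm_num at h2 ⊢
    linarith
  refine ⟨key, ?_⟩
  rintro ⟨σ, hσ, hdl⟩
  obtain ⟨-, -, h, h5⟩ := key σ hσ
  have h' := hdl 0 0
  have e : release p3 φ3 0 0 + d3 0 = 5 := by
    simp [release, φ3, d3]
    norm_num
  linarith
end

section
/- For all real numbers t_1, t_2, φ, d and every real p > 0, the number of indices j ∈ ℕ with φ + j·p ≥ t_1 and φ + j·p + d ≤ t_2 equals max{ 0, ⌊(t_2 − φ − d)/p⌋ − max{ 0, ⌈(t_1 − φ)/p⌉ } + 1 } (where ⌊·⌋ and ⌈·⌉ denote the integer floor and ceiling, and the cardinality is taken as an integer). -/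
/-- Closed-form count of the jobs of a periodic task (offset `φ`, period `p > 0`, relative
deadline `d`; job `j ∈ ℕ` released at `φ + j·p` with absolute deadline `φ + j·p + d`) that
are released at or after `t1` and have absolute deadline at or before `t2`. -/
theorem stmt5 (t1 t2 φ d p : ℝ) (hp : 0 < p) :
    (({j : ℕ | t1 ≤ φ + (j : ℝ) * p ∧ φ + (j : ℝ) * p + d ≤ t2}).ncard : ℤ) =
      max 0 (⌊(t2 - φ - d) / p⌋ - max 0 ⌈(t1 - φ) / p⌉ + 1) := by
  have h : {j : ℕ | t1 ≤ φ + (j : ℝ) * p ∧ φ + (j : ℝ) * p + d ≤ t2} =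
      ((Finset.Ico (⌈(t1 - φ) / p⌉).toNat (⌊(t2 - φ - d) / p⌋ + 1).toNat : Finset ℕ) : Set ℕ) := by
    ext j
    have h1 : t1 ≤ φ + (j : ℝ) * p ↔ ⌈(t1 - φ) / p⌉ ≤ (j : ℤ) := by
      rw [Int.ceil_le, div_le_iff₀ hp, Int.cast_natCast]
      constructor <;> intro h <;> linarith
    have h2 : φ + (j : ℝ) * p + d ≤ t2 ↔ (j : ℤ) ≤ ⌊(t2 - φ - d) / p⌋ := by
      rw [Int.le_floor, le_div_iff₀ hp, Int.cast_natCast]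
      constructor <;> intro h <;> linarith
    rw [Set.mem_setOf_eq, h1, h2, Finset.mem_coe, Finset.mem_Ico]
    omega
  rw [h, Set.ncard_coe_finset, Nat.card_Ico]
  omega
end

section
/- Let φ, d, t_1, t_2 be real numbers, p > 0 a real number, and s, f, l natural numbers with f ≥ 1 and l ≥ 1. Then the number of pairs (j, m) ∈ ℕ × ℕ with m ≤ f − 1, φ + (s + m)·p + j·l·p ≥ t_1 and φ + (s + m)·p + j·l·p + d ≤ t_2 equals Σ_{m=0}^{f−1} max{ 0, ⌊(t_2 − (s + m)·p − φ − d)/(l·p)⌋ − max{ 0, ⌈(t_1 − (s + m)·p − φ)/(l·p)⌉ } + 1 }. -/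
/-- Closed-form count of extended frames of a security-aware periodic task: for a periodic
cumulative authentication policy with initial offset `s`, block length `f ≥ 1` and
inter-authentication distance `l ≥ 1`, the number of pairs `(j, m) ∈ ℕ × ℕ` with
`m ≤ f - 1` such that the frame released at `φ + (s + m)·p + j·l·p` is released at or
after `t1` and has its absolute deadline `d` later at or before `t2` equals the sum over
`m` of per-`m` closed-form counts. -/
theorem stmt6 (φ d t1 t2 p : ℝ) (hp : 0 < p) (s f l : ℕ) (hf : 1 ≤ f) (hl : 1 ≤ l) :
    (({x : ℕ × ℕ | x.2 < f ∧
        t1 ≤ φ + ((s + x.2 : ℕ) : ℝ) * p + (x.1 : ℝ) * (l : ℝ) * p ∧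
        φ + ((s + x.2 : ℕ) : ℝ) * p + (x.1 : ℝ) * (l : ℝ) * p + d ≤ t2}).ncard : ℤ) =
      ∑ m ∈ Finset.range f,
        max 0 (⌊(t2 - ((s + m : ℕ) : ℝ) * p - φ - d) / ((l : ℝ) * p)⌋ -
          max 0 ⌈(t1 - ((s + m : ℕ) : ℝ) * p - φ) / ((l : ℝ) * p)⌉ + 1) := by
  have hlp : 0 < (l : ℝ) * p := mul_pos (by exact_mod_cast hl) hp
  let A : ℕ → ℤ := fun m => max 0 ⌈(t1 - ((s + m : ℕ) : ℝ) * p - φ) / ((l : ℝ) * p)⌉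
  let B : ℕ → ℤ := fun m => ⌊(t2 - ((s + m : ℕ) : ℝ) * p - φ - d) / ((l : ℝ) * p)⌋
  let S : Finset (Σ _ : ℕ, ℤ) := (Finset.range f).sigma (fun m => Finset.Icc (A m) (B m))
  have key : ∀ m j : ℕ, (A m ≤ (j : ℤ) ∧ (j : ℤ) ≤ B m) ↔
      (t1 ≤ φ + ((s + m : ℕ) : ℝ) * p + (j : ℝ) * (l : ℝ) * p ∧
        φ + ((s + m : ℕ) : ℝ) * p + (j : ℝ) * (l : ℝ) * p + d ≤ t2) := by
    intro m j
    have e : (j : ℝ) * (l : ℝ) * p = (j : ℝ) * ((l : ℝ) * p) := by ring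
    simp only [A, B, max_le_iff, Int.ceil_le, Int.le_floor, Int.cast_natCast,
      div_le_iff₀ hlp, le_div_iff₀ hlp, e]
    constructor
    · rintro ⟨⟨_, h1⟩, h2⟩
      constructor <;> linarith
    · rintro ⟨h1, h2⟩
      refine ⟨⟨by positivity, ?_⟩, ?_⟩ <;> linarith
  have hA : ∀ m, 0 ≤ A m := fun m => le_max_left _ _
  have hset : {x : ℕ × ℕ | x.2 < f ∧
        t1 ≤ φ + ((s + x.2 : ℕ) : ℝ) * p + (x.1 : ℝ) * (l : ℝ) * p ∧
        φ + ((s + x.2 : ℕ) : ℝ) * p + (x.1 : ℝ) * (l : ℝ) * p + d ≤ t2} =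
      ((S.image (fun x => (x.2.toNat, x.1)) : Finset (ℕ × ℕ)) : Set (ℕ × ℕ)) := by
    ext ⟨j, m⟩
    rw [Set.mem_setOf_eq, ← key m j, Finset.mem_coe, Finset.mem_image]
    constructor
    · rintro ⟨h1, h2⟩
      exact ⟨⟨m, (j : ℤ)⟩, by simp [S, h1, h2], by simp⟩
    · rintro ⟨⟨m', z⟩, h, he⟩
      simp only [S, Finset.mem_sigma, Finset.mem_range, Finset.mem_Icc] at h
      simp only [Prod.mk.injEq] at he
      obtain ⟨he1, rfl⟩ := he
      have := hA m'
      have hz : (j : ℤ) = z := by omega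
      rw [hz]
      exact h
  rw [hset, Set.ncard_coe_finset, Finset.card_image_of_injOn, Finset.card_sigma, Nat.cast_sum]
  · refine Finset.sum_congr rfl fun m _ => ?_
    rw [Int.card_Icc, Int.toNat_eq_max]
    simp only [A, B]
    rw [max_comm]
    congr 1
    ring
  · rintro ⟨m, z⟩ h ⟨m', z'⟩ h' he
    simp only [S, Finset.coe_sigma, Set.mem_sigma_iff, Finset.mem_coe, Finset.mem_range,
      Finset.mem_Icc] at h h'
    simp only [Prod.mk.injEq] at he
    obtain ⟨he1, rfl⟩ := he
    have := hA m
    have hz : z = z' := by omega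
    rw [hz]
end

section
/- Let s, f, l be natural numbers with 1 ≤ f ≤ l. Then the map (j, m) ↦ s + m + j·l from ℕ × {0, …, f − 1} to ℕ is injective, and consequently, for a task with offset φ ∈ ℝ, period p > 0 and relative deadline d ∈ ℝ, and extended-frame index set E = { s + m + j·l : j ∈ ℕ, 0 ≤ m ≤ f − 1 }, for all real t_1, t_2: |{ h ∈ E : φ + h·p ≥ t_1 and φ + h·p + d ≤ t_2 }| = Σ_{m=0}^{f−1} max{ 0, ⌊(t_2 − (s + m)·p − φ − d)/(l·p)⌋ − max{ 0, ⌈(t_1 − (s + m)·p − φ)/(l·p)⌉ } + 1 }. -/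
/-- For `1 ≤ f ≤ l`, the map `(j, m) ↦ s + m + j·l` is injective on `ℕ × {0, …, f-1}`,
and consequently the number of extended-frame jobs (those with index in
`E = {s + m + j·l : j ∈ ℕ, 0 ≤ m ≤ f-1}`, job `h` released at `φ + h·p` with absolute
deadline `φ + h·p + d`) released at or after `t1` with absolute deadline at or before `t2`
equals the sum over `m` of per-block closed-form counts. -/
theorem stmt7 (s f l : ℕ) (hf : 1 ≤ f) (hfl : f ≤ l) (φ d p : ℝ) (hp : 0 < p) :
    Set.InjOn (fun x : ℕ × ℕ => s + x.2 + x.1 * l) {x : ℕ × ℕ | x.2 < f} ∧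
    ∀ t1 t2 : ℝ,
      (({h : ℕ | (∃ j m : ℕ, m < f ∧ h = s + m + j * l) ∧
          t1 ≤ φ + (h : ℝ) * p ∧ φ + (h : ℝ) * p + d ≤ t2}).ncard : ℤ) =
        ∑ m ∈ Finset.range f,
          max 0 (⌊(t2 - ((s + m : ℕ) : ℝ) * p - φ - d) / ((l : ℝ) * p)⌋ -
            max 0 ⌈(t1 - ((s + m : ℕ) : ℝ) * p - φ) / ((l : ℝ) * p)⌉ + 1) := by
  have hl : 0 < l := by omega
  have inj : Set.InjOn (fun x : ℕ × ℕ => s + x.2 + x.1 * l) {x : ℕ × ℕ | x.2 < f} := by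
    rintro ⟨j, m⟩ hm ⟨j', m'⟩ hm' h
    simp only [Set.mem_setOf_eq] at hm hm' h
    have h1 : m + j * l = m' + j' * l := by omega
    have h2 : m = m' := by
      have := congrArg (· % l) h1
      simpa [Nat.add_mul_mod_self_right, Nat.mod_eq_of_lt (lt_of_lt_of_le hm hfl),
        Nat.mod_eq_of_lt (lt_of_lt_of_le hm' hfl)] using this
    subst h2
    have h3 : j * l = j' * l := by omega
    rw [Nat.eq_of_mul_eq_mul_right hl h3]
  refine ⟨inj, fun t1 t2 => ?_⟩
  have hlp : 0 < (l : ℝ) * p := mul_pos (by exact_mod_cast hl) hp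
  let F : ℕ → Finset ℤ := fun m =>
    Finset.Icc (max 0 ⌈(t1 - ((s + m : ℕ) : ℝ) * p - φ) / ((l : ℝ) * p)⌉)
      ⌊(t2 - ((s + m : ℕ) : ℝ) * p - φ - d) / ((l : ℝ) * p)⌋
  have key : ∀ m j : ℕ, (j : ℤ) ∈ F m ↔
      (t1 ≤ φ + ((s + m + j * l : ℕ) : ℝ) * p ∧
        φ + ((s + m + j * l : ℕ) : ℝ) * p + d ≤ t2) := by
    intro m j
    simp only [F, Finset.mem_Icc, max_le_iff, Int.ceil_le, Int.le_floor, div_le_iff₀ hlp,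
      le_div_iff₀ hlp]
    push_cast
    constructor
    · rintro ⟨⟨_, h1⟩, h2⟩
      constructor <;> linarith
    · rintro ⟨h1, h2⟩
      refine ⟨⟨by positivity, ?_⟩, ?_⟩ <;> linarith
  have hnn : ∀ m, ∀ j ∈ F m, 0 ≤ j := by
    intro m j hj
    simp only [F, Finset.mem_Icc, max_le_iff] at hj
    exact hj.1.1
  have hset : {h : ℕ | (∃ j m : ℕ, m < f ∧ h = s + m + j * l) ∧
          t1 ≤ φ + (h : ℝ) * p ∧ φ + (h : ℝ) * p + d ≤ t2} =
      ((((Finset.range f).sigma F).image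
        (fun x : (_ : ℕ) × ℤ => s + x.1 + x.2.toNat * l) : Finset ℕ) : Set ℕ) := by
    ext h
    simp only [Set.mem_setOf_eq, Finset.coe_image, Set.mem_image, Finset.mem_coe,
      Finset.mem_sigma, Finset.mem_range]
    constructor
    · rintro ⟨⟨j, m, hm, rfl⟩, hh⟩
      exact ⟨⟨m, (j : ℤ)⟩, ⟨hm, (key m j).2 hh⟩, by simp⟩
    · rintro ⟨⟨m, j⟩, ⟨hm, hj⟩, rfl⟩
      obtain ⟨n, rfl⟩ := Int.eq_ofNat_of_zero_le (hnn m j hj)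
      exact ⟨⟨n, m, hm, by simp⟩, by simpa using (key m n).1 hj⟩
  rw [hset, Set.ncard_coe_finset, Finset.card_image_of_injOn, Finset.card_sigma]
  · rw [Nat.cast_sum]
    refine Finset.sum_congr rfl fun m _ => ?_
    simp only [F, Int.card_Icc]
    omega
  · rintro ⟨m, j⟩ hx ⟨m', j'⟩ hx' h
    simp only [Finset.mem_coe, Finset.mem_sigma, Finset.mem_range] at hx hx'
    obtain ⟨n, rfl⟩ := Int.eq_ofNat_of_zero_le (hnn m j hx.2)
    obtain ⟨n', rfl⟩ := Int.eq_ofNat_of_zero_le (hnn m' j' hx'.2)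
    have := @inj (n, m) hx.1 (n', m') hx'.1 (by simpa using h)
    simp only [Prod.mk.injEq] at this
    obtain ⟨rfl, rfl⟩ := this
    rfl
end

section
/- Let T_1(c_1,p_1,φ_1,d_1), …, T_N(c_N,p_N,φ_N,d_N) be periodic tasks with c_i > 0, p_i > 0, φ_i ≥ 0, d_i > 0. Then Σ_{i=1}^N df_i(t_1, t_2) ≤ t_2 − t_1 holds for all real t_1 < t_2 if and only if it holds for all pairs (t_1, t_2) with t_1 < t_2 such that t_1 is a job release instant of some task (t_1 = φ_i + k_1·p_i for some i and k_1 ∈ ℕ) and t_2 is a job deadline instant of some task (t_2 = φ_j + d_j + k_2·p_j for some j and k_2 ∈ ℕ). -/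
/-- The processor-demand condition holds for all intervals if and only if it holds for all
intervals whose left endpoint is a job release instant of some task and whose right
endpoint is a job deadline instant of some task. -/
theorem stmt11 {N : ℕ} (c p φ d : Fin N → ℝ)
    (hc : ∀ i, 0 < c i) (hp : ∀ i, 0 < p i) (hφ : ∀ i, 0 ≤ φ i) (hd : ∀ i, 0 < d i) :
    (∀ t1 t2 : ℝ, t1 < t2 →
        ∑ i, demand (c i) (p i) (φ i) (d i) t1 t2 ≤ t2 - t1) ↔
      (∀ t1 t2 : ℝ, t1 < t2 →
        (∃ i : Fin N, ∃ k1 : ℕ, t1 = φ i + (k1 : ℝ) * p i) →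
        (∃ j : Fin N, ∃ k2 : ℕ, t2 = φ j + d j + (k2 : ℝ) * p j) →
        ∑ i, demand (c i) (p i) (φ i) (d i) t1 t2 ≤ t2 - t1) := by
  refine ⟨fun h t1 t2 ht _ _ => h t1 t2 ht, fun h t1 t2 ht => ?_⟩
  -- the finite set of jobs contained in `[t1, t2]`
  let S : Set (Fin N × ℕ) := {x | t1 ≤ φ x.1 + (x.2 : ℝ) * p x.1 ∧
    φ x.1 + (x.2 : ℝ) * p x.1 + d x.1 ≤ t2}
  have hfin1 : ∀ i, ({j : ℕ | t1 ≤ φ i + (j : ℝ) * p i ∧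
      φ i + (j : ℝ) * p i + d i ≤ t2}).Finite := by
    intro i
    refine (Set.finite_Iic (⌈(t2 - d i - φ i) / p i⌉₊)).subset ?_
    rintro j ⟨_, hj⟩
    have h1 : (j : ℝ) ≤ (t2 - d i - φ i) / p i := by
      rw [le_div_iff₀ (hp i)]
      linarith
    exact Set.mem_Iic.mpr (by exact_mod_cast h1.trans (Nat.le_ceil _))
  have hS : S.Finite := by
    refine (Set.finite_iUnion (fun i => (hfin1 i).image (fun j => (i, j)))).subset ?_
    rintro ⟨i, j⟩ hx
    exact Set.mem_iUnion.mpr ⟨i, j, hx, rfl⟩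
  rcases S.eq_empty_or_nonempty with hE | hne
  · have h0 : ∀ i, demand (c i) (p i) (φ i) (d i) t1 t2 = 0 := by
      intro i
      have he : {j : ℕ | t1 ≤ φ i + (j : ℝ) * p i ∧
          φ i + (j : ℝ) * p i + d i ≤ t2} = ∅ := by
        ext j
        simp only [Set.mem_empty_iff_false, iff_false]
        intro hj
        have : ((i, j) : Fin N × ℕ) ∈ S := hj
        rw [hE] at this
        exact this
      unfold demand
      rw [he]
      simp
    simp only [h0, Finset.sum_const_zero]
    linarith
  · obtain ⟨a, haS, ha⟩ := Set.exists_min_image S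
      (fun x => φ x.1 + (x.2 : ℝ) * p x.1) hS hne
    obtain ⟨b, hbS, hb⟩ := Set.exists_max_image S
      (fun x => φ x.1 + (x.2 : ℝ) * p x.1 + d x.1) hS hne
    have hab := hb a haS
    have hda := hd a.1
    have ha1 := haS.1
    have hb2 := hbS.2
    have key := h (φ a.1 + (a.2 : ℝ) * p a.1) (φ b.1 + (b.2 : ℝ) * p b.1 + d b.1)
      (by linarith) ⟨a.1, a.2, rfl⟩ ⟨b.1, b.2, by ring⟩
    have heq : ∀ i, demand (c i) (p i) (φ i) (d i) t1 t2 =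
        demand (c i) (p i) (φ i) (d i) (φ a.1 + (a.2 : ℝ) * p a.1)
          (φ b.1 + (b.2 : ℝ) * p b.1 + d b.1) := by
      intro i
      unfold demand
      congr 3
      ext j
      constructor
      · intro hj
        exact ⟨ha (i, j) hj, hb (i, j) hj⟩
      · rintro ⟨h1, h2⟩
        exact ⟨ha1.trans h1, h2.trans hb2⟩
    simp only [heq]
    linarith
end

section
/- Let T be a periodic task with worst-case execution time c > 0, period p > 0, offset φ ≥ 0 and relative deadline d > 0. Then for every natural number n and all real numbers t_1, t_2 with t_1 ≥ φ: df(t_1 + n·p, t_2 + n·p) = df(t_1, t_2). -/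
/-- Shift-invariance of the demand function beyond the task's offset: shifting the
interval by any whole number of periods does not change the demand, provided the left
endpoint is at or after the offset. -/
theorem stmt12 (c p φ d : ℝ) (hc : 0 < c) (hp : 0 < p) (hφ : 0 ≤ φ) (hd : 0 < d)
    (n : ℕ) (t1 t2 : ℝ) (ht1 : φ ≤ t1) :
    demand c p φ d (t1 + (n : ℝ) * p) (t2 + (n : ℝ) * p) = demand c p φ d t1 t2 := by
  unfold demand
  congr 2
  rw [← Set.ncard_image_of_injective
    {j : ℕ | t1 ≤ φ + (j : ℝ) * p ∧ φ + (j : ℝ) * p + d ≤ t2} (add_left_injective n)]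
  congr 1
  ext j
  simp only [Set.mem_setOf_eq, Set.mem_image]
  constructor
  · rintro ⟨h1, h2⟩
    have hnj : n ≤ j := by
      have h : (n : ℝ) * p ≤ (j : ℝ) * p := by linarith
      exact_mod_cast le_of_mul_le_mul_right h hp
    obtain ⟨k, rfl⟩ := Nat.exists_eq_add_of_le' hnj
    push_cast at h1 h2
    exact ⟨k, ⟨by linarith, by linarith⟩, rfl⟩
  · rintro ⟨k, ⟨h1, h2⟩, rfl⟩
    push_cast
    exact ⟨by linarith, by linarith⟩
end
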